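/- Let d ≥ 1 and let G be a countable group of automorphisms of the rooted d-ary tree T_d, acting on the boundary ∂T_d = {0,…,d−1}^ℕ by the induced boundary action (characterized by: for every g ∈ G, every ray ξ and every n, the length-n prefix of g·ξ equals g applied to the length-n prefix of ξ). Let μ be the uniform Bernoulli measure on ∂T_d, i.e., the product of uniform measures on {0,…,d−1}. Then G acts level transitively on T_d if and only if the boundary action of G is ergodic with respect to μ, i.e., every Borel subset of ∂T_d invariant under every element of G has μ-measure 0 or 1. -/

import Mathlib

open MeasureTheory
open scoped ENNReal

/-- A tree automorphism of the rooted `d`-ary tree (vertices = finite words over `Fin d`):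
a permutation of the vertex set preserving word length and the prefix relation in both
directions. -/
def IsTreeAut {d : ℕ} (f : Equiv.Perm (List (Fin d))) : Prop :=
  (∀ u : List (Fin d), (f u).length = u.length) ∧
    ∀ u v : List (Fin d), u <+: v ↔ f u <+: f v

/-- The length-`n` prefix of a boundary ray `ξ ∈ {0,…,d-1}^ℕ`. -/
def rayPrefix {d : ℕ} (ξ : ℕ → Fin d) (n : ℕ) : List (Fin d) :=
  List.ofFn fun i : Fin n => ξ i

/-- The set of boundary rays passing through the vertex `u`. -/
def rayCylinder {d : ℕ} (u : List (Fin d)) : Set (ℕ → Fin d) :=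
  {ξ | rayPrefix ξ u.length = u}

section Rays

variable {d : ℕ}

@[simp]
theorem length_rayPrefix (ξ : ℕ → Fin d) (n : ℕ) : (rayPrefix ξ n).length = n := by
  simp [rayPrefix]

theorem rayPrefix_getElem?_eq_some {ξ : ℕ → Fin d} {i n : ℕ} (h : i < n) (a : Fin d) :
    (rayPrefix ξ n)[i]? = some a ↔ ξ i = a := by
  simp [rayPrefix, h]

theorem rayPrefix_isPrefix (ξ : ℕ → Fin d) {m n : ℕ} (h : m ≤ n) :
    rayPrefix ξ m <+: rayPrefix ξ n := by
  rw [List.prefix_iff_eq_take]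
  apply List.ext_getElem
  · simp [h]
  · intro i _ _
    simp [rayPrefix]

theorem measurableSet_rayPrefix_mem (n : ℕ) (A : Set (List (Fin d))) :
    MeasurableSet {ξ : ℕ → Fin d | rayPrefix ξ n ∈ A} := by
  have hf : Measurable fun (ξ : ℕ → Fin d) (i : Fin n) => ξ i := by fun_prop
  exact hf (Set.toFinite {w : Fin n → Fin d | List.ofFn w ∈ A}).measurableSet

theorem measurableSet_rayCylinder (u : List (Fin d)) : MeasurableSet (rayCylinder u) :=
  measurableSet_rayPrefix_mem u.length {u}

theorem rayCylinder_subset_of_isPrefix {u v : List (Fin d)} (h : u <+: v) :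
    rayCylinder v ⊆ rayCylinder u := by
  intro ξ (hξ : rayPrefix ξ v.length = v)
  have h' := rayPrefix_isPrefix ξ h.length_le
  rw [hξ] at h'
  exact (List.prefix_of_prefix_length_le h' h (by simp)).eq_of_length (by simp)

theorem isPiSystem_range_rayCylinder : IsPiSystem (Set.range (rayCylinder (d := d))) := by
  rintro _ ⟨u, rfl⟩ _ ⟨v, rfl⟩ ⟨ξ, hu, hv⟩
  wlog h : u.length ≤ v.length generalizing u v
  · rw [Set.inter_comm]
    exact this v u hv hu (by omega)
  have huv : u <+: v := by
    have h' := rayPrefix_isPrefix ξ h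
    rwa [show rayPrefix ξ u.length = u from hu, show rayPrefix ξ v.length = v from hv] at h'
  exact ⟨v, (Set.inter_eq_right.2 (rayCylinder_subset_of_isPrefix huv)).symm⟩

theorem generateFrom_range_rayCylinder :
    (inferInstance : MeasurableSpace (ℕ → Fin d)) =
      MeasurableSpace.generateFrom (Set.range rayCylinder) := by
  apply le_antisymm
  · refine iSup_le fun i => Measurable.comap_le ?_
    refine @measurable_to_countable' _ _ _ _ (_) _ fun a => ?_
    have : (fun ξ : ℕ → Fin d => ξ i) ⁻¹' {a} =
        ⋃ u ∈ {u : List (Fin d) | u.length = i + 1 ∧ u[i]? = some a}, rayCylinder u := by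
      ext ξ
      simp only [Set.mem_preimage, Set.mem_singleton_iff, Set.mem_iUnion, Set.mem_ofPred_eq,
        exists_prop, rayCylinder]
      constructor
      · intro h
        exact ⟨rayPrefix ξ (i + 1), ⟨by simp, (rayPrefix_getElem?_eq_some (by omega) a).2 h⟩,
          by simp⟩
      · rintro ⟨u, ⟨hl, ha⟩, hu⟩
        rw [← hu, hl] at ha
        exact (rayPrefix_getElem?_eq_some (by omega) a).1 ha
    rw [this]
    exact MeasurableSet.biUnion (Set.to_countable _) fun u _ =>
      MeasurableSpace.measurableSet_generateFrom ⟨u, rfl⟩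
  · refine MeasurableSpace.generateFrom_le ?_
    rintro _ ⟨u, rfl⟩
    exact measurableSet_rayCylinder u

theorem ext_of_rayCylinder {μ ν : Measure (ℕ → Fin d)} [IsFiniteMeasure μ]
    (h : ∀ u, μ (rayCylinder u) = ν (rayCylinder u)) : μ = ν := by
  refine ext_of_generate_finite _ generateFrom_range_rayCylinder isPiSystem_range_rayCylinder ?_ ?_
  · rintro _ ⟨u, rfl⟩
    exact h u
  · simpa [rayCylinder, rayPrefix] using h []

theorem sum_measure_rayCylinder_ofFn (ν : Measure (ℕ → Fin d)) (n : ℕ) :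
    ∑ w : Fin n → Fin d, ν (rayCylinder (List.ofFn w)) = ν Set.univ := by
  have hf : Measurable fun (ξ : ℕ → Fin d) (i : Fin n) => ξ i := by fun_prop
  have h := sum_measure_preimage_singleton (μ := ν) Finset.univ
    (f := fun (ξ : ℕ → Fin d) (i : Fin n) => ξ i) fun y _ => hf (measurableSet_singleton y)
  rw [Finset.coe_univ, Set.preimage_univ] at h
  rw [← h]
  refine Finset.sum_congr rfl fun w _ => congrArg ν ?_
  ext ξ
  simp only [rayCylinder, Set.mem_ofPred_eq, List.length_ofFn, rayPrefix, Set.mem_preimage,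
    Set.mem_singleton_iff]
  exact List.ofFn_injective.eq_iff

/-- A finite measure giving equal mass to all cylinders of the same length is proportional to
the uniform Bernoulli measure. -/
theorem eq_smul_of_rayCylinder_eq (hd : 1 ≤ d) {μ ν : Measure (ℕ → Fin d)} [IsFiniteMeasure ν]
    (hμ : ∀ u, μ (rayCylinder u) = (d : ℝ≥0∞)⁻¹ ^ u.length)
    (hν : ∀ u v : List (Fin d), u.length = v.length → ν (rayCylinder u) = ν (rayCylinder v)) :
    ν = ν Set.univ • μ := by
  refine ext_of_rayCylinder fun u => ?_
  have hsum := sum_measure_rayCylinder_ofFn ν u.length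
  rw [Finset.sum_congr rfl fun w _ => hν (List.ofFn w) u (by simp)] at hsum
  have hd0 : (d : ℝ≥0∞) ^ u.length ≠ 0 := pow_ne_zero _ (by exact_mod_cast (by omega : d ≠ 0))
  have hdt : (d : ℝ≥0∞) ^ u.length ≠ ∞ := ENNReal.pow_ne_top (ENNReal.natCast_ne_top d)
  simp only [Finset.sum_const, Finset.card_univ, Fintype.card_pi, Fintype.card_fin,
    Finset.prod_const, nsmul_eq_mul, Nat.cast_pow] at hsum
  rw [Measure.smul_apply, hμ, smul_eq_mul, ← hsum, ← ENNReal.inv_pow, mul_right_comm,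
    ENNReal.mul_inv_cancel hd0 hdt, one_mul]

section BoundaryMap

variable {f : Equiv.Perm (List (Fin d))} {τ : (ℕ → Fin d) → (ℕ → Fin d)}

theorem measurable_of_rayPrefix_eq (hτ : ∀ ξ n, rayPrefix (τ ξ) n = f (rayPrefix ξ n)) :
    Measurable τ := by
  refine measurable_pi_lambda _ fun i => measurable_to_countable' fun a => ?_
  convert measurableSet_rayPrefix_mem (i + 1) {l : List (Fin d) | (f l)[i]? = some a} using 1
  ext ξ
  simp only [Set.mem_preimage, Set.mem_singleton_iff, Set.mem_ofPred_eq, ← hτ]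
  exact (rayPrefix_getElem?_eq_some (by omega) a).symm

theorem preimage_rayCylinder_apply (hf : ∀ u, (f u).length = u.length)
    (hτ : ∀ ξ n, rayPrefix (τ ξ) n = f (rayPrefix ξ n)) (u : List (Fin d)) :
    τ ⁻¹' rayCylinder (f u) = rayCylinder u := by
  ext ξ
  simp [rayCylinder, hτ, hf]

theorem measurePreserving_of_rayPrefix_eq (hf : ∀ u, (f u).length = u.length)
    (hτ : ∀ ξ n, rayPrefix (τ ξ) n = f (rayPrefix ξ n)) {μ : Measure (ℕ → Fin d)}
    [IsFiniteMeasure μ]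
    (hμ : ∀ u, μ (rayCylinder u) = (d : ℝ≥0∞)⁻¹ ^ u.length) : MeasurePreserving τ μ μ := by
  refine ⟨measurable_of_rayPrefix_eq hτ, ext_of_rayCylinder fun v => ?_⟩
  obtain ⟨u, rfl⟩ := f.surjective v
  rw [Measure.map_apply (measurable_of_rayPrefix_eq hτ) (measurableSet_rayCylinder _),
    preimage_rayCylinder_apply hf hτ, hμ, hμ, hf]

end BoundaryMap

end Rays

/-- Let `d ≥ 1` and let a countable group `G` act on the rooted `d`-ary tree
by automorphisms (via `ρ`), with induced boundary action `σ` on `∂T_d = (Fin d)^ℕ`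
(characterized by: the length-`n` prefix of `σ g ξ` equals `ρ g` applied to the length-`n`
prefix of `ξ`).  Let `μ` be the uniform Bernoulli measure on the boundary (characterized by
its values `d^{-n}` on length-`n` cylinders).  Then `G` acts level transitively on the tree
iff the boundary action is ergodic for `μ` (every Borel set invariant under every element
of `G` has measure `0` or `1`). -/
theorem stmt_14 {d : ℕ} (hd : 1 ≤ d) {G : Type*} [Group G] [Countable G]
    (ρ : G →* Equiv.Perm (List (Fin d))) (htree : ∀ g : G, IsTreeAut (ρ g))
    (σ : G → (ℕ → Fin d) → (ℕ → Fin d))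
    (hσ : ∀ (g : G) (ξ : ℕ → Fin d) (n : ℕ),
      rayPrefix (σ g ξ) n = ρ g (rayPrefix ξ n))
    (μ : Measure (ℕ → Fin d)) [IsProbabilityMeasure μ]
    (hμ : ∀ u : List (Fin d),
      μ {ξ : ℕ → Fin d | rayPrefix ξ u.length = u} = ((d : ℝ≥0∞))⁻¹ ^ u.length) :
    (∀ u v : List (Fin d), u.length = v.length → ∃ g : G, ρ g u = v) ↔
      (∀ s : Set (ℕ → Fin d), MeasurableSet s → (∀ g : G, σ g ⁻¹' s = s) →
        μ s = 0 ∨ μ s = 1) := by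
  replace hμ : ∀ u, μ (rayCylinder u) = (d : ℝ≥0∞)⁻¹ ^ u.length := hμ
  constructor
  · intro htrans s hs hinv
    have hcyl : ∀ u v : List (Fin d), u.length = v.length →
        μ.restrict s (rayCylinder u) = μ.restrict s (rayCylinder v) := by
      intro u v huv
      obtain ⟨g, rfl⟩ := htrans u v huv
      rw [Measure.restrict_apply (measurableSet_rayCylinder _),
        Measure.restrict_apply (measurableSet_rayCylinder _),
        ← (measurePreserving_of_rayPrefix_eq (htree g).1 (hσ g) hμ).measure_preimage
          ((measurableSet_rayCylinder (ρ g u)).inter hs).nullMeasurableSet,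
        Set.preimage_inter, hinv g, preimage_rayCylinder_apply (htree g).1 (hσ g)]
    have h := congrArg (· s) (eq_smul_of_rayCylinder_eq hd hμ hcyl)
    simp only [Measure.restrict_apply_self, Measure.smul_apply, Measure.restrict_apply_univ,
      smul_eq_mul] at h
    rw [or_iff_not_imp_left]
    intro h0
    exact (ENNReal.mul_right_inj h0 (measure_ne_top μ s)).1 (by rw [mul_one]; exact h.symm)
  · intro herg u v huv
    have hpos : ∀ w, μ (rayCylinder w) ≠ 0 := fun w => by
      rw [hμ]
      exact pow_ne_zero _ (ENNReal.inv_ne_zero.2 (ENNReal.natCast_ne_top d))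
    set s : Set (ℕ → Fin d) :=
      {ξ | rayPrefix ξ u.length ∈ {w : List (Fin d) | ∃ g : G, ρ g u = w}} with hs_def
    have hs : MeasurableSet s := measurableSet_rayPrefix_mem _ _
    have hinv : ∀ g : G, σ g ⁻¹' s = s := by
      intro g
      ext ξ
      simp only [hs_def, Set.mem_preimage, Set.mem_ofPred_eq, hσ]
      constructor
      · rintro ⟨k, hk⟩
        exact ⟨g⁻¹ * k, by simp [hk]⟩
      · rintro ⟨k, hk⟩
        exact ⟨g * k, by simp [hk]⟩
    by_contra hne
    rcases herg s hs hinv with h | h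
    · have hsub : rayCylinder u ⊆ s := fun ξ hξ => ⟨1, by simpa using Eq.symm hξ⟩
      exact hpos u (measure_mono_null hsub h)
    · have hsub : rayCylinder v ⊆ sᶜ := by
        rintro ξ hξ ⟨g, hg⟩
        exact hne ⟨g, by rw [hg, huv]; exact hξ⟩
      exact hpos v (measure_mono_null hsub ((prob_compl_eq_zero_iff hs).2 h))
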